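/- arXiv:1907.10690 — 2 statements merged into one kernel-verified Lean document; each statement's English description precedes it below -/
import Mathlib

section
/- In the standing setup of degree 2 (a quasi-cyclic DG-Lie algebra of degree 2 with a splitting L = H ⊕ d(K) ⊕ K such that H^i = 0 for i < 0, H^0 is closed under the bracket, H^i and K^i are H^0-submodules for all i, and H ⊥ K), define for 0 < j < p and ξ₁,…,ξ_p ∈ H^1 the scalar I_j^p(ξ₁,…,ξ_p) = (ι_j(ξ₁,…,ξ_j), ι_{p-j}(ξ_{j+1},…,ξ_p)). Then: (a) for every 0 < j < p, all ξ₁,…,ξ_p ∈ H^1 and every g ∈ H^0, Σ_{i=1}^p I_j^p(ξ₁,…,{ξ_i,g}₂,…,ξ_p) = 0; (b) for every p ≥ 2, I^{p+1}_1 = I^{p+1}_p = 0 identically on (H^1)^{×(p+1)}. -/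
/-!
Core definitions: differential graded Lie algebras (DGLAs) over a field `K`,
their cohomology, morphisms, quasi-isomorphisms, zigzags and formality.

A ℤ-graded vector space is encoded as a module `carrier` together with an internal
direct sum decomposition `grading : ℤ → Submodule K carrier`.
-/

/-- A differential graded Lie algebra over `K`.  The differential `d` has degree `+1`,
the bracket `br` is graded skew-symmetric, satisfies the graded Jacobi identity and
`d` is a graded derivation with respect to it. -/
structure DGLA (K : Type) [Field K] : Type 1 where
  carrier : Type
  [acg : AddCommGroup carrier]
  [mod : Module K carrier]
  grading : ℤ → Submodule K carrier
  internal : DirectSum.IsInternal grading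
  d : carrier → carrier
  d_lin : IsLinearMap K d
  d_mem : ∀ i : ℤ, ∀ x ∈ grading i, d x ∈ grading (i + 1)
  d_sq : ∀ x, d (d x) = 0
  br : carrier → carrier → carrier
  br_lin₁ : ∀ y, IsLinearMap K fun x => br x y
  br_lin₂ : ∀ x, IsLinearMap K (br x)
  br_mem : ∀ i j : ℤ, ∀ x ∈ grading i, ∀ y ∈ grading j, br x y ∈ grading (i + j)
  skew : ∀ i j : ℤ, ∀ x ∈ grading i, ∀ y ∈ grading j,
      br x y = -((-1 : K) ^ (i * j) • br y x)
  jacobi : ∀ i j : ℤ, ∀ x ∈ grading i, ∀ y ∈ grading j, ∀ z : carrier,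
      br x (br y z) = br (br x y) z + (-1 : K) ^ (i * j) • br y (br x z)
  leibniz : ∀ i : ℤ, ∀ x ∈ grading i, ∀ y : carrier,
      d (br x y) = br (d x) y + (-1 : K) ^ i • br x (d y)

attribute [instance] DGLA.acg DGLA.mod

variable {K : Type} [Field K]

/-- The differential bundled as a linear map. -/
def DGLA.dHom (A : DGLA K) : A.carrier →ₗ[K] A.carrier := IsLinearMap.mk' A.d A.d_lin

/-- Degree `i` cocycles. -/
def DGLA.cocycles (A : DGLA K) (i : ℤ) : Submodule K A.carrier :=
  A.grading i ⊓ LinearMap.ker A.dHom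

/-- Degree `i` coboundaries. -/
def DGLA.coboundaries (A : DGLA K) (i : ℤ) : Submodule K A.carrier :=
  A.grading i ⊓ LinearMap.range A.dHom

/-- Degree `i` cohomology `H^i(L)` as a quotient vector space. -/
abbrev DGLA.cohomology (A : DGLA K) (i : ℤ) :=
  A.cocycles i ⧸ ((A.coboundaries i).comap (A.cocycles i).subtype)

/-- A morphism of DGLAs. -/
structure DGLAHom (A B : DGLA K) where
  toFun : A.carrier → B.carrier
  lin : IsLinearMap K toFun
  map_grading : ∀ i : ℤ, ∀ x ∈ A.grading i, toFun x ∈ B.grading i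
  map_d : ∀ x, toFun (A.d x) = B.d (toFun x)
  map_br : ∀ x y, toFun (A.br x y) = B.br (toFun x) (toFun y)

/-- `f` is a quasi-isomorphism: it induces bijections on cohomology in every degree. -/
def DGLAHom.IsQuasiIso {A B : DGLA K} (f : DGLAHom A B) : Prop :=
  ∀ i : ℤ,
    (∀ x ∈ A.cocycles i, f.toFun x ∈ B.coboundaries i → x ∈ A.coboundaries i) ∧
    (∀ y ∈ B.cocycles i, ∃ x ∈ A.cocycles i, f.toFun x - y ∈ B.coboundaries i)

/-- There exists a quasi-isomorphism `A → B`. -/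
def QIso (A B : DGLA K) : Prop := ∃ f : DGLAHom A B, f.IsQuasiIso

/-- Two DGLAs are connected by a zigzag of quasi-isomorphisms. -/
inductive ZigzagQIso : DGLA K → DGLA K → Prop
  | of {A B : DGLA K} : QIso A B → ZigzagQIso A B
  | refl (A : DGLA K) : ZigzagQIso A A
  | symm {A B : DGLA K} : ZigzagQIso A B → ZigzagQIso B A
  | trans {A B C : DGLA K} : ZigzagQIso A B → ZigzagQIso B C → ZigzagQIso A C

/-- A DGLA is formal if it is connected by a zigzag of quasi-isomorphisms to a DGLA
with zero differential.  (This is equivalent to being connected by a zigzag of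
quasi-isomorphisms to its cohomology `H^*(L)` endowed with the zero differential and
the induced bracket: any zero-differential DGLA quasi-isomorphic to `L` is isomorphic,
as a graded Lie algebra, to `H^*(L)` with the induced bracket.) -/
def DGLA.IsFormal (A : DGLA K) : Prop :=
  ∃ M : DGLA K, (∀ x, M.d x = 0) ∧ ZigzagQIso A M

/-- A quasi-cyclic DGLA of degree `n`: a DGLA with finite dimensional cohomology
equipped with a graded symmetric bilinear form of degree `-n`, compatible with `d`
and cyclic with respect to the bracket, whose induced pairing on cohomology is
non-degenerate. -/
structure QCyclicDGLA (K : Type) [Field K] (n : ℤ) extends DGLA K where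
  form : carrier → carrier → K
  form_lin₁ : ∀ y, IsLinearMap K fun x => form x y
  form_lin₂ : ∀ x, IsLinearMap K (form x)
  findim : ∀ i : ℤ, FiniteDimensional K (toDGLA.cohomology i)
  form_degree : ∀ i j : ℤ, i + j ≠ n → ∀ x ∈ grading i, ∀ y ∈ grading j, form x y = 0
  form_symm : ∀ i j : ℤ, ∀ x ∈ grading i, ∀ y ∈ grading j,
      form x y = (-1 : K) ^ (i * j) * form y x
  form_d : ∀ i : ℤ, ∀ x ∈ grading i, ∀ y,
      form (d x) y = (-1 : K) ^ (i + 1) * form x (d y)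
  form_cyclic : ∀ x y z, form (br x y) z = form x (br y z)
  nondeg : ∀ i : ℤ, ∀ x ∈ toDGLA.cocycles i,
      (∀ y ∈ toDGLA.cocycles (n - i), form x y = 0) → x ∈ toDGLA.coboundaries i

/-- A splitting `L = H ⊕ d(K) ⊕ K` of the complex `(L, d)` into graded subspaces:
`d` vanishes on `H`, is injective on `K = Kc`, and in every degree `i` one has the
internal direct sum `L^i = H^i ⊕ d(K^{i-1}) ⊕ K^i`. -/
structure GradedSplitting (A : DGLA K) where
  H : ℤ → Submodule K A.carrier
  Kc : ℤ → Submodule K A.carrier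
  H_le : ∀ i, H i ≤ A.grading i
  Kc_le : ∀ i, Kc i ≤ A.grading i
  d_H : ∀ i, ∀ x ∈ H i, A.d x = 0
  d_Kc_inj : ∀ i, ∀ x ∈ Kc i, A.d x = 0 → x = 0
  decomp : ∀ i, H i ⊔ ((Kc (i - 1)).map A.dHom ⊔ Kc i) = A.grading i
  disj₁ : ∀ i, Disjoint (H i) ((Kc (i - 1)).map A.dHom ⊔ Kc i)
  disj₂ : ∀ i, Disjoint ((Kc (i - 1)).map A.dHom) (Kc i)

/-- The contraction data `(π, h)` determined by a splitting `L = H ⊕ d(K) ⊕ K`: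
`pr` is the projection onto `H`, and `h` the degree `-1` homotopy given by projecting
onto `d(K)`, applying `-d⁻¹` and including `K` into `L`.  The listed identities
determine `pr` and `h` uniquely. -/
structure ContractionData (A : DGLA K) (S : GradedSplitting A) where
  pr : A.carrier → A.carrier
  h : A.carrier → A.carrier
  pr_lin : IsLinearMap K pr
  h_lin : IsLinearMap K h
  pr_H : ∀ i : ℤ, ∀ x ∈ S.H i, pr x = x
  pr_dK : ∀ i : ℤ, ∀ x ∈ S.Kc i, pr (A.d x) = 0
  pr_K : ∀ i : ℤ, ∀ x ∈ S.Kc i, pr x = 0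
  h_H : ∀ i : ℤ, ∀ x ∈ S.H i, h x = 0
  h_dK : ∀ i : ℤ, ∀ x ∈ S.Kc i, h (A.d x) = -x
  h_K : ∀ i : ℤ, ∀ x ∈ S.Kc i, h x = 0
/-!  Homotopy transfer: Koszul signs, shuffles, and the recursively defined
Taylor coefficients `ι_p` and transferred brackets `{⋯}_p`. -/

/-- `(-1)^m` in `K` for an integer `m`. -/
def negOnePowK (K : Type) [Field K] (m : ℤ) : K := (-1 : K) ^ m.natAbs

/-- The antisymmetric Koszul sign `χ(σ)` of a permutation `σ` acting on homogeneous
elements of degrees `dg 0, …, dg (P-1)`: a product over the inversions of `σ` of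
`-(-1)^{|ξ_a||ξ_b|}`. -/
def koszulSign (K : Type) [Field K] {P : ℕ} (dg : Fin P → ℤ) (σ : Equiv.Perm (Fin P)) : K :=
  ∏ q ∈ Finset.univ.filter
      (fun q : Fin P × Fin P => q.1 < q.2 ∧ σ q.2 < σ q.1),
    -negOnePowK K (dg (σ q.1) * dg (σ q.2))

/-- The sign `(-1)^{α(σ)}` with `α(σ) = (1-P+k)(k + Σ_{i<k} |ξ_{σ(i)}|)`. -/
def alphaSign (K : Type) [Field K] {P : ℕ} (k : ℕ) (dg : Fin P → ℤ) (σ : Equiv.Perm (Fin P)) : K :=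
  negOnePowK K ((1 - (P : ℤ) + (k : ℤ)) *
    ((k : ℤ) + ∑ i ∈ Finset.univ.filter (fun i : Fin P => (i : ℕ) < k), dg (σ i)))

/-- The set of `(k, P-k)`-shuffles in the symmetric group of `Fin P`. -/
def shuffles (P k : ℕ) : Finset (Equiv.Perm (Fin P)) :=
  Finset.univ.filter fun σ =>
    ∀ i j : Fin P, i < j → ((j : ℕ) < k ∨ k ≤ (i : ℕ)) → σ i < σ j

/-- Auxiliary total indexing function `ℕ → Fin (p+2)` (reduction mod `p+2`);
on the ranges actually used in the transfer formulas it is the obvious inclusion. -/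
def finIdx (p : ℕ) (m : ℕ) : Fin (p + 2) := ⟨m % (p + 2), Nat.mod_lt m (by omega)⟩

/-- The first `j` entries of a `p`-tuple. -/
def tupleTake {M : Type} (p j : ℕ) (h : j ≤ p) (v : Fin p → M) : Fin j → M :=
  fun i => v (Fin.castLE h i)

/-- The last `p - j` entries of a `p`-tuple. -/
def tupleDrop {M : Type} (p j : ℕ) (h : j ≤ p) (v : Fin p → M) : Fin (p - j) → M :=
  fun i => v ⟨j + (i : ℕ), by have := i.isLt; omega⟩

variable {K : Type} [Field K]

/-- The homotopy transfer family associated to a splitting with contraction data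
`(pr, h)`: `ι p` are the Taylor coefficients of the induced `L∞` quasi-isomorphism
`H → L` and `bh p` the transferred higher brackets on `H ≅ H^*(L)`, characterized
(on tuples of homogeneous elements of `H`) by `ι 1 = inclusion` together with the
standard recursive shuffle formulas. -/
structure IsTransfer (A : DGLA K) (S : GradedSplitting A) (C : ContractionData A S)
    (ι : (p : ℕ) → (Fin p → A.carrier) → A.carrier)
    (bh : (p : ℕ) → (Fin p → A.carrier) → A.carrier) : Prop where
  iota_one : ∀ v : Fin 1 → A.carrier, ι 1 v = v 0
  iota_rec : ∀ (p : ℕ) (dg : Fin (p + 2) → ℤ) (v : Fin (p + 2) → A.carrier),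
      (∀ i, v i ∈ S.H (dg i)) →
      ι (p + 2) v = (2 : K)⁻¹ •
        ∑ k ∈ Finset.Ioo 0 (p + 2), ∑ σ ∈ shuffles (p + 2) k,
          (koszulSign K dg σ * alphaSign K k dg σ) •
            C.h (A.br (ι k fun i => v (σ (finIdx p (i : ℕ))))
                 (ι (p + 2 - k) fun i => v (σ (finIdx p (k + (i : ℕ))))))
  bracket_rec : ∀ (p : ℕ) (dg : Fin (p + 2) → ℤ) (v : Fin (p + 2) → A.carrier),
      (∀ i, v i ∈ S.H (dg i)) →
      bh (p + 2) v = (2 : K)⁻¹ •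
        ∑ k ∈ Finset.Ioo 0 (p + 2), ∑ σ ∈ shuffles (p + 2) k,
          (koszulSign K dg σ * alphaSign K k dg σ) •
            C.pr (A.br (ι k fun i => v (σ (finIdx p (i : ℕ))))
                  (ι (p + 2 - k) fun i => v (σ (finIdx p (k + (i : ℕ))))))

/-- The scalar `I_j^p(ξ₁, …, ξ_p) = (ι_j(ξ₁, …, ξ_j), ι_{p-j}(ξ_{j+1}, …, ξ_p))`. -/
def Ipair {K : Type} [Field K] {n : ℤ} (A : QCyclicDGLA K n)
    (ι : (p : ℕ) → (Fin p → A.carrier) → A.carrier)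
    (p j : ℕ) (h : j ≤ p) (v : Fin p → A.carrier) : K :=
  A.form (ι j (tupleTake p j h v)) (ι (p - j) (tupleDrop p j h v))

theorem Fin.sum_univ_take_drop {N : Type*} [AddCommMonoid N] {p k : ℕ} (h : k ≤ p)
    (f : Fin p → N) :
    ∑ i, f i = ∑ i : Fin k, f (Fin.castLE h i) +
      ∑ i : Fin (p - k), f ⟨k + i, by have := i.isLt; omega⟩ := by
  rw [← (finCongr (Nat.add_sub_of_le h)).sum_comp, Fin.sum_univ_add]
  rfl

theorem sum_update_take_drop {M : Type} {N : Type*} [AddCommMonoid N] {p k : ℕ} (h : k ≤ p)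
    (F : (Fin k → M) → (Fin (p - k) → M) → N) (D : M → M) (w : Fin p → M) :
    ∑ i, F (tupleTake p k h (Function.update w i (D (w i))))
        (tupleDrop p k h (Function.update w i (D (w i)))) =
      ∑ i, F (Function.update (tupleTake p k h w) i (D (tupleTake p k h w i)))
        (tupleDrop p k h w) +
      ∑ i, F (tupleTake p k h w)
        (Function.update (tupleDrop p k h w) i (D (tupleDrop p k h w i))) := by
  rw [Fin.sum_univ_take_drop h]
  congr 1 <;> refine Finset.sum_congr rfl fun i _ => ?_ <;> congr 1 <;> ext j <;>
    simp only [tupleTake, tupleDrop, Function.update_apply, Fin.ext_iff, Fin.val_castLE]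
  · have := j.isLt
    have := i.isLt
    rw [if_neg (by omega)]
  · have := j.isLt
    have := i.isLt
    rw [if_neg (by omega)]
  · simp only [Nat.add_left_cancel_iff]

theorem tupleTake_comp_eq {M : Type} (p k : ℕ) (h : k ≤ p + 2) (v : Fin (p + 2) → M)
    (σ : Equiv.Perm (Fin (p + 2))) :
    (fun i : Fin k => v (σ (finIdx p i))) = tupleTake (p + 2) k h (v ∘ σ) := by
  ext i
  have := i.isLt
  simp only [tupleTake, Function.comp_apply]
  congr 2
  ext
  exact Nat.mod_eq_of_lt (by omega)

theorem tupleDrop_comp_eq {M : Type} (p k : ℕ) (h : k ≤ p + 2) (v : Fin (p + 2) → M)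
    (σ : Equiv.Perm (Fin (p + 2))) :
    (fun i : Fin (p + 2 - k) => v (σ (finIdx p (k + i)))) =
      tupleDrop (p + 2) k h (v ∘ σ) := by
  ext i
  have := i.isLt
  simp only [tupleDrop, Function.comp_apply]
  congr 2
  ext
  exact Nat.mod_eq_of_lt (by omega)

namespace DGLA

theorem br_degree_zero_right (A : DGLA K) {i : ℤ} {x g : A.carrier} (hx : x ∈ A.grading i)
    (hg : g ∈ A.grading 0) : A.br x g = -A.br g x := by
  simpa using A.skew i 0 x hx g hg

theorem br_br_degree_zero_right (A : DGLA K) {i j : ℤ} {x y g : A.carrier}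
    (hx : x ∈ A.grading i) (hy : y ∈ A.grading j) (hg : g ∈ A.grading 0) :
    A.br (A.br x y) g = A.br (A.br x g) y + A.br x (A.br y g) := by
  have e₁ := (A.br_lin₁ y).map_neg (A.br g x)
  have e₂ := (A.br_lin₂ x).map_neg (A.br g y)
  have e₃ := A.jacobi 0 i g hg x hx y
  rw [zero_mul, zpow_zero, one_smul] at e₃
  rw [A.br_degree_zero_right (A.br_mem i j x hx y hy) hg, A.br_degree_zero_right hx hg,
    A.br_degree_zero_right hy hg, e₁, e₂, e₃, neg_add]

end DGLA

namespace ContractionData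

variable {A : DGLA K} {S : GradedSplitting A} (C : ContractionData A S)

theorem exists_decomp (S : GradedSplitting A) {i : ℤ} {x : A.carrier} (hx : x ∈ A.grading i) :
    ∃ a ∈ S.H i, ∃ b ∈ S.Kc (i - 1), ∃ c ∈ S.Kc i, x = a + (A.d b + c) := by
  rw [← S.decomp i] at hx
  obtain ⟨a, ha, y, hy, rfl⟩ := Submodule.mem_sup.1 hx
  obtain ⟨_, ⟨b, hb, rfl⟩, c, hc, rfl⟩ := Submodule.mem_sup.1 hy
  exact ⟨a, ha, b, hb, c, hc, rfl⟩

theorem h_decomp {i j : ℤ} {a b c : A.carrier} (ha : a ∈ S.H i) (hb : b ∈ S.Kc j)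
    (hc : c ∈ S.Kc i) : C.h (a + (A.d b + c)) = -b := by
  rw [C.h_lin.map_add, C.h_lin.map_add, C.h_H i a ha, C.h_dK j b hb, C.h_K i c hc, zero_add,
    add_zero]

theorem h_mem_Kc {i : ℤ} {x : A.carrier} (hx : x ∈ A.grading i) : C.h x ∈ S.Kc (i - 1) := by
  obtain ⟨a, ha, b, hb, c, hc, rfl⟩ := exists_decomp S hx
  rw [C.h_decomp ha hb hc]
  exact neg_mem hb

theorem h_br_right
    (hH : ∀ i : ℤ, ∀ g ∈ S.H 0, ∀ x ∈ S.H i, A.br g x ∈ S.H i)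
    (hK : ∀ i : ℤ, ∀ g ∈ S.H 0, ∀ x ∈ S.Kc i, A.br g x ∈ S.Kc i)
    {g : A.carrier} (hg : g ∈ S.H 0) {i : ℤ} {x : A.carrier} (hx : x ∈ A.grading i) :
    C.h (A.br x g) = A.br (C.h x) g := by
  have hg₀ := S.H_le 0 hg
  rw [A.br_degree_zero_right hx hg₀,
    A.br_degree_zero_right (S.Kc_le _ (C.h_mem_Kc hx)) hg₀, C.h_lin.map_neg]
  congr 1
  obtain ⟨a, ha, b, hb, c, hc, rfl⟩ := exists_decomp S hx
  have e : A.br g (A.d b) = A.d (A.br g b) := by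
    rw [A.leibniz 0 g hg₀ b, S.d_H 0 g hg, (A.br_lin₁ b).map_zero, zpow_zero, one_smul, zero_add]
  rw [C.h_decomp ha hb hc, (A.br_lin₂ g).map_add, (A.br_lin₂ g).map_add, e,
    C.h_decomp (hH i g hg a ha) (hK _ g hg b hb) (hK i g hg c hc), (A.br_lin₂ g).map_neg]

end ContractionData

namespace IsTransfer

variable {A : DGLA K} {S : GradedSplitting A} {C : ContractionData A S}
  {ι bh : (p : ℕ) → (Fin p → A.carrier) → A.carrier}

theorem iota_eq (hT : IsTransfer A S C ι bh) (p : ℕ) (v : Fin (p + 2) → A.carrier)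
    (hv : ∀ i, v i ∈ S.H 1) :
    ι (p + 2) v = (2 : K)⁻¹ •
      ∑ k : Finset.Ioo 0 (p + 2), ∑ σ ∈ shuffles (p + 2) k,
        (koszulSign K (fun _ => 1) σ * alphaSign K k (fun _ => 1) σ) •
          C.h (A.br
            (ι k (tupleTake (p + 2) k (Finset.mem_Ioo.1 k.2).2.le (v ∘ σ)))
            (ι (p + 2 - k) (tupleDrop (p + 2) k (Finset.mem_Ioo.1 k.2).2.le (v ∘ σ)))) := by
  rw [hT.iota_rec p (fun _ => 1) v hv, ← Finset.sum_coe_sort]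
  refine congrArg _ (Finset.sum_congr rfl fun k _ => Finset.sum_congr rfl fun σ _ => ?_)
  rw [tupleTake_comp_eq p k (Finset.mem_Ioo.1 k.2).2.le,
    tupleDrop_comp_eq p k (Finset.mem_Ioo.1 k.2).2.le]

theorem iota_mem_grading_one (hT : IsTransfer A S C ι bh) (p : ℕ) (hp : 0 < p)
    (v : Fin p → A.carrier) (hv : ∀ i, v i ∈ S.H 1) :
    ι p v ∈ A.grading 1 ∧ (2 ≤ p → ι p v ∈ S.Kc 1) := by
  induction p using Nat.strong_induction_on with
  | _ p ih =>
    match p, hp with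
    | 1, _ =>
      rw [hT.iota_one]
      exact ⟨S.H_le 1 (hv 0), fun h => absurd h (by norm_num)⟩
    | p + 2, _ =>
      suffices hK : ι (p + 2) v ∈ S.Kc 1 from ⟨S.Kc_le 1 hK, fun _ => hK⟩
      rw [hT.iota_eq p v hv]
      refine Submodule.smul_mem _ _ (Submodule.sum_mem _ fun k _ => Submodule.sum_mem _
        fun σ _ => Submodule.smul_mem _ _ ?_)
      obtain ⟨hk₀, hk⟩ := Finset.mem_Ioo.1 k.2
      exact C.h_mem_Kc (A.br_mem 1 1 _ (ih k hk hk₀ _ fun i => hv _).1 _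
        (ih (p + 2 - k) (by omega) (by omega) _ fun i => hv _).1)

/-- The Taylor coefficients are equivariant under the right action of `H⁰`. -/
theorem sum_iota_update (hT : IsTransfer A S C ι bh)
    (hH : ∀ i : ℤ, ∀ g ∈ S.H 0, ∀ x ∈ S.H i, A.br g x ∈ S.H i)
    (hK : ∀ i : ℤ, ∀ g ∈ S.H 0, ∀ x ∈ S.Kc i, A.br g x ∈ S.Kc i)
    {g : A.carrier} (hg : g ∈ S.H 0) (p : ℕ) (hp : 0 < p)
    (v : Fin p → A.carrier) (hv : ∀ i, v i ∈ S.H 1) :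
    ∑ i, ι p (Function.update v i (A.br (v i) g)) = A.br (ι p v) g := by
  have hg₀ := S.H_le 0 hg
  induction p using Nat.strong_induction_on with
  | _ p ih =>
    match p, hp with
    | 1, _ => simp [hT.iota_one]
    | p + 2, _ =>
      have hD : ∀ i, A.br (v i) g ∈ S.H 1 := fun i => by
        rw [A.br_degree_zero_right (S.H_le 1 (hv i)) hg₀]
        exact neg_mem (hH 1 g hg _ (hv i))
      have hu : ∀ i j, Function.update v i (A.br (v i) g) j ∈ S.H 1 := fun i j => by
        rw [Function.update_apply]
        split_ifs
        exacts [hD i, hv j]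
      let R : A.carrier →ₗ[K] A.carrier := IsLinearMap.mk' _ (A.br_lin₁ g)
      change _ = R _
      rw [hT.iota_eq p v hv, Finset.sum_congr rfl fun i _ => hT.iota_eq p _ (hu i),
        ← Finset.smul_sum, map_smul, map_sum, Finset.sum_comm]
      refine congrArg _ (Finset.sum_congr rfl fun k _ => ?_)
      rw [map_sum, Finset.sum_comm]
      refine Finset.sum_congr rfl fun σ _ => ?_
      rw [map_smul, ← Finset.smul_sum]
      refine congrArg _ ?_
      obtain ⟨hk₀, hk⟩ := Finset.mem_Ioo.1 k.2
      have hm : 0 < p + 2 - k := by omega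
      have hx := (hT.iota_mem_grading_one k hk₀
        (tupleTake (p + 2) k hk.le (v ∘ σ)) fun i => hv _).1
      have hy := (hT.iota_mem_grading_one (p + 2 - k) hm
        (tupleDrop (p + 2) k hk.le (v ∘ σ)) fun i => hv _).1
      change _ = A.br (C.h _) g
      rw [← C.h_br_right hH hK hg (A.br_mem 1 1 _ hx _ hy),
        A.br_br_degree_zero_right hx hy hg₀,
        ← ih k hk hk₀ (tupleTake (p + 2) k hk.le (v ∘ σ)) fun i => hv _,
        ← ih (p + 2 - k) (by omega) hm (tupleDrop (p + 2) k hk.le (v ∘ σ)) fun i => hv _]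
      have hσ : ∀ i, Function.update v (σ i) (A.br (v (σ i)) g) ∘ σ =
          Function.update (v ∘ σ) i (A.br ((v ∘ σ) i) g) := fun i =>
        Function.update_comp_eq_of_injective v σ.injective i _
      rw [← Equiv.sum_comp σ]
      simp only [hσ]
      rw [sum_update_take_drop hk.le (fun a b => C.h (A.br (ι k a) (ι (p + 2 - k) b)))
        (fun x => A.br x g) (v ∘ σ)]
      let h' : A.carrier →ₗ[K] A.carrier := IsLinearMap.mk' _ C.h_lin
      have e₁ (y : A.carrier) (s : Fin k → A.carrier) :
          ∑ i, C.h (A.br (s i) y) = C.h (A.br (∑ i, s i) y) :=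
        (map_sum (h' ∘ₗ IsLinearMap.mk' _ (A.br_lin₁ y)) s Finset.univ).symm
      have e₂ (x : A.carrier) (s : Fin (p + 2 - k) → A.carrier) :
          ∑ i, C.h (A.br x (s i)) = C.h (A.br x (∑ i, s i)) :=
        (map_sum (h' ∘ₗ IsLinearMap.mk' _ (A.br_lin₂ x)) s Finset.univ).symm
      rw [e₁, e₂, C.h_lin.map_add]

end IsTransfer

/-- **Lemma.**  In the standing setup of degree `2`:
(a) for `0 < j < p`, `ξ₁, …, ξ_p ∈ H^1` and `g ∈ H^0`,
`Σ_{i=1}^p I_j^p(ξ₁, …, {ξ_i, g}₂, …, ξ_p) = 0`;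
(b) for `p ≥ 2`, `I^{p+1}_1 = I^{p+1}_p = 0` on `(H^1)^{p+1}`. -/
theorem Ipair_invariance_and_vanishing
    {K : Type} [Field K] [CharZero K]
    (A : QCyclicDGLA K 2) (S : GradedSplitting A.toDGLA)
    (h1 : ∀ i : ℤ, i < 0 → S.H i = ⊥)
    (h2 : ∀ x ∈ S.H 0, ∀ y ∈ S.H 0, A.br x y ∈ S.H 0)
    (h3H : ∀ i : ℤ, ∀ g ∈ S.H 0, ∀ x ∈ S.H i, A.br g x ∈ S.H i)
    (h3K : ∀ i : ℤ, ∀ g ∈ S.H 0, ∀ x ∈ S.Kc i, A.br g x ∈ S.Kc i)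
    (hperp : ∀ i j : ℤ, ∀ x ∈ S.H i, ∀ y ∈ S.Kc j, A.form x y = 0)
    (C : ContractionData A.toDGLA S)
    (ι bh : (p : ℕ) → (Fin p → A.carrier) → A.carrier)
    (hT : IsTransfer A.toDGLA S C ι bh) :
    -- (a)
    (∀ (p j : ℕ) (hj : 0 < j) (hjp : j < p),
      ∀ v : Fin p → A.carrier, (∀ i, v i ∈ S.H 1) → ∀ g ∈ S.H 0,
        ∑ i : Fin p,
          Ipair A ι p j (le_of_lt hjp)
            (Function.update v i (C.pr (A.br (v i) g))) = 0) ∧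
    -- (b)
    (∀ (p : ℕ) (hp : 2 ≤ p), ∀ v : Fin (p + 1) → A.carrier, (∀ i, v i ∈ S.H 1) →
      Ipair A ι (p + 1) 1 (by omega) v = 0 ∧
      Ipair A ι (p + 1) p (by omega) v = 0) := by
  constructor
  · intro p j hj hjp v hv g hg
    have hg₀ := S.H_le 0 hg
    have hpr : ∀ i, C.pr (A.br (v i) g) = A.br (v i) g := fun i => by
      refine C.pr_H 1 _ ?_
      rw [A.br_degree_zero_right (S.H_le 1 (hv i)) hg₀]
      exact neg_mem (h3H 1 g hg _ (hv i))
    have hm : 0 < p - j := Nat.sub_pos_of_lt hjp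
    have hy := (hT.iota_mem_grading_one (p - j) hm (tupleDrop p j hjp.le v) fun i => hv _).1
    simp only [hpr, Ipair]
    rw [sum_update_take_drop hjp.le (fun a b => A.form (ι j a) (ι (p - j) b))
      (fun x => A.br x g) v]
    have e₁ (y : A.carrier) (s : Fin j → A.carrier) :
        ∑ i, A.form (s i) y = A.form (∑ i, s i) y :=
      (map_sum (IsLinearMap.mk' _ (A.form_lin₁ y)) s Finset.univ).symm
    have e₂ (x : A.carrier) (s : Fin (p - j) → A.carrier) :
        ∑ i, A.form x (s i) = A.form x (∑ i, s i) :=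
      (map_sum (IsLinearMap.mk' _ (A.form_lin₂ x)) s Finset.univ).symm
    rw [e₁, e₂, hT.sum_iota_update h3H h3K hg j hj (tupleTake p j hjp.le v) fun i => hv _,
      hT.sum_iota_update h3H h3K hg (p - j) hm (tupleDrop p j hjp.le v) fun i => hv _,
      A.form_cyclic,
      A.br_degree_zero_right hy hg₀, (A.form_lin₂ _).map_neg, add_neg_cancel]
  · intro p hp v hv
    constructor
    · rw [Ipair, hT.iota_one]
      exact hperp 1 1 _ (hv _) _
        ((hT.iota_mem_grading_one (p + 1 - 1) (by omega) _ fun i => hv _).2 (by omega))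
    · have hx := (hT.iota_mem_grading_one p (by omega)
        (tupleTake (p + 1) p (by omega) v) fun i => hv _).2 hp
      have hy : ι (p + 1 - p) (tupleDrop (p + 1) p (by omega) v) ∈ S.H 1 := by
        have aux : ∀ (m : ℕ) (w : Fin m → A.carrier), m = 1 → (∀ i, w i ∈ S.H 1) →
            ι m w ∈ S.H 1 := by
          rintro _ w rfl hw
          rw [hT.iota_one]
          exact hw 0
        exact aux _ _ (by omega) fun i => hv _
      rw [Ipair, A.form_symm 1 1 _ (S.Kc_le 1 hx) _ (S.H_le 1 hy), hperp 1 1 _ hy _ hx, mul_zero]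
end

section
/- In the standing setup of degree 2, define f₁ = id_H, f₂ = 0, and for p ≥ 3 define f_p : (H^1)^{⊙p} → H^1 recursively by (f_p(ξ₁,…,ξ_p), ξ_{p+1}) = (1/2) Σ_{j=2}^{p-1} Σ_{σ∈S(j,p-j)} (I^{p+1}_j − F^{p+1}_j)(ξ_{σ(1)},…,ξ_{σ(p)}, ξ_{p+1}) for all ξ_{p+1} ∈ H^1, where I_j^p(ξ₁,…,ξ_p) = (ι_j(ξ₁,…,ξ_j), ι_{p-j}(ξ_{j+1},…,ξ_p)) and F^{p+1}_j(ξ₁,…,ξ_{p+1}) = (f_j(ξ₁,…,ξ_j), f_{p-j+1}(ξ_{j+1},…,ξ_{p+1})). Then for every p ≥ 2, every 1 < j < p, all ξ₁,…,ξ_{p+1} ∈ H^1 and every g ∈ H^0: (a) Σ_{i=1}^p f_p(ξ₁,…,{ξ_i,g}₂,…,ξ_p) = {f_p(ξ₁,…,ξ_p), g}₂, and (b) Σ_{i=1}^{p+1} F_j^{p+1}(ξ₁,…,{ξ_i,g}₂,…,ξ_{p+1}) = 0. -/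
variable {K : Type} [Field K]

variable {K : Type} [Field K]

/-- The scalar `F_j^p(ξ₁, …, ξ_p) = (f_j(ξ₁, …, ξ_j), f_{p-j}(ξ_{j+1}, …, ξ_p))`. -/
def Fpair {K : Type} [Field K] {n : ℤ} (A : QCyclicDGLA K n)
    (f : (p : ℕ) → (Fin p → A.carrier) → A.carrier)
    (p j : ℕ) (h : j ≤ p) (v : Fin p → A.carrier) : K :=
  A.form (f j (tupleTake p j h v)) (f (p - j) (tupleDrop p j h v))

/-- The family `f₁ = id`, `f₂ = 0`, and for `p ≥ 3` the maps
`f_p : (H^1)^{⊙p} → H^1` recursively determined (through the non-degenerate pairing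
on `H^1`) by
`(f_p(ξ₁,…,ξ_p), ξ_{p+1}) = (1/2) Σ_{j=2}^{p-1} Σ_{σ ∈ S(j,p-j)}
   (I^{p+1}_j − F^{p+1}_j)(ξ_{σ(1)},…,ξ_{σ(p)}, ξ_{p+1})`. -/
structure IsFFamily {K : Type} [Field K] {n : ℤ}
    (A : QCyclicDGLA K n) (S : GradedSplitting A.toDGLA)
    (ι : (p : ℕ) → (Fin p → A.carrier) → A.carrier)
    (f : (p : ℕ) → (Fin p → A.carrier) → A.carrier) : Prop where
  f_one : ∀ v : Fin 1 → A.carrier, f 1 v = v 0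
  f_two : ∀ v : Fin 2 → A.carrier, f 2 v = 0
  f_mem : ∀ p : ℕ, 3 ≤ p → ∀ v : Fin p → A.carrier,
      (∀ i, v i ∈ S.H 1) → f p v ∈ S.H 1
  f_rec : ∀ p : ℕ, 3 ≤ p → ∀ v : Fin p → A.carrier, (∀ i, v i ∈ S.H 1) →
      ∀ ξ ∈ S.H 1,
      A.form (f p v) ξ = (2 : K)⁻¹ *
        ∑ j ∈ (Finset.Ico 2 p).attach, ∑ σ ∈ shuffles p j.1,
          (Ipair A ι (p + 1) j.1
              (by have := (Finset.mem_Ico.mp j.2).2; omega)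
              (Fin.snoc (fun i => v (σ i)) ξ)
            - Fpair A f (p + 1) j.1
              (by have := (Finset.mem_Ico.mp j.2).2; omega)
              (Fin.snoc (fun i => v (σ i)) ξ))

section

open Function

/-- The Leibniz rule for a bilinear map applied to two multi-argument functions whose arguments
partition the entries of a tuple, provided that the operator `D` derives both functions. -/
theorem sum_bilin_update {K M N : Type*} [CommRing K] [AddCommGroup M] [Module K M]
    [AddCommGroup N] [Module K N] {κ l n : Type*} [Fintype κ] [Fintype l] [Fintype n]
    [DecidableEq κ] [DecidableEq l] [DecidableEq n]
    (B : M →ₗ[K] M →ₗ[K] N) (D : M → M) (e : κ ⊕ l ≃ n)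
    (a : (κ → M) → M) (b : (l → M) → M) (v : n → M)
    (ha : ∑ s, a (update (fun s => v (e (.inl s))) s (D (v (e (.inl s))))) =
      D (a fun s => v (e (.inl s))))
    (hb : ∑ t, b (update (fun t => v (e (.inr t))) t (D (v (e (.inr t))))) =
      D (b fun t => v (e (.inr t)))) :
    ∑ i, B (a fun s => update v i (D (v i)) (e (.inl s)))
        (b fun t => update v i (D (v i)) (e (.inr t))) =
      B (D (a fun s => v (e (.inl s)))) (b fun t => v (e (.inr t))) +
        B (a fun s => v (e (.inl s))) (D (b fun t => v (e (.inr t)))) := by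
  have upd_inl_inl (s : κ) (x : M) : (fun s' => update v (e (.inl s)) x (e (.inl s'))) =
      update (fun s' => v (e (.inl s'))) s x := by
    ext s'; simp [update_apply]
  have upd_inr_inr (t : l) (x : M) : (fun t' => update v (e (.inr t)) x (e (.inr t'))) =
      update (fun t' => v (e (.inr t'))) t x := by
    ext t'; simp [update_apply]
  have upd_inl_inr (s : κ) (x : M) : (fun t => update v (e (.inl s)) x (e (.inr t))) =
      fun t => v (e (.inr t)) := by
    ext t; simp
  have upd_inr_inl (t : l) (x : M) : (fun s => update v (e (.inr t)) x (e (.inl s))) =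
      fun s => v (e (.inl s)) := by
    ext s; simp
  rw [← e.sum_comp, Fintype.sum_sum_type, ← ha, ← hb]
  simp only [upd_inl_inl, upd_inr_inr, upd_inl_inr, upd_inr_inl, map_sum, LinearMap.sum_apply]

/-- The bijection splitting the indices of a tuple of length `p` after the first `j` entries. -/
def splitFin (p j : ℕ) (h : j ≤ p) : Fin j ⊕ Fin (p - j) ≃ Fin p :=
  finSumFinEquiv.trans (finCongr (Nat.add_sub_cancel' h))

namespace DGLA

variable {K : Type} [Field K] (A : DGLA K)

/-- The bracket bundled as a bilinear map. -/
def brHom : A.carrier →ₗ[K] A.carrier →ₗ[K] A.carrier :=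
  LinearMap.mk₂ K A.br (fun x y z => (A.br_lin₁ z).map_add x y)
    (fun c x z => (A.br_lin₁ z).map_smul c x) (fun x => (A.br_lin₂ x).map_add)
    (fun c x => (A.br_lin₂ x).map_smul c)

@[simp] theorem brHom_apply (x y : A.carrier) : A.brHom x y = A.br x y := rfl

/-- Right bracketing with `g`, as a linear map. -/
def rightBr (g : A.carrier) : A.carrier →ₗ[K] A.carrier := A.brHom.flip g

@[simp] theorem rightBr_apply (g x : A.carrier) : A.rightBr g x = A.br x g := rfl

variable {A}

theorem linearMap_ext_grading {N : Type*} [AddCommGroup N] [Module K N]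
    {φ ψ : A.carrier →ₗ[K] N} (h : ∀ i, ∀ x ∈ A.grading i, φ x = ψ x) : φ = ψ := by
  apply LinearMap.ext_on (s := ⋃ i, (A.grading i : Set A.carrier))
  · rw [Submodule.span_iUnion]
    simpa using A.internal.submodule_iSup_eq_top
  · intro x hx
    obtain ⟨i, hi⟩ := Set.mem_iUnion.1 hx
    exact h i x hi

theorem br_skew_of_mem_zero {g : A.carrier} (hg : g ∈ A.grading 0) (x : A.carrier) :
    A.br x g = -A.br g x := by
  have : A.rightBr g = -A.brHom g := linearMap_ext_grading fun i x hx => by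
    simpa using A.skew i 0 x hx g hg
  exact LinearMap.congr_fun this x

theorem rightBr_br {g : A.carrier} (hg : g ∈ A.grading 0) (x y : A.carrier) :
    A.rightBr g (A.br x y) = A.br (A.rightBr g x) y + A.br x (A.rightBr g y) := by
  have key : (A.brHom.flip y).comp (A.brHom g) + (A.brHom.flip (A.br g y)) =
      (A.brHom g).comp (A.brHom.flip y) := linearMap_ext_grading fun i x hx => by
    simpa using (A.jacobi 0 i g hg x hx y).symm
  have := LinearMap.congr_fun key x
  simp only [LinearMap.add_apply, LinearMap.comp_apply, LinearMap.flip_apply, brHom_apply] at this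
  have hl : A.br (-A.br g x) y = -A.br (A.br g x) y := (A.br_lin₁ y).map_neg _
  have hr : A.br x (-A.br g y) = -A.br x (A.br g y) := (A.br_lin₂ x).map_neg _
  simp only [rightBr_apply, br_skew_of_mem_zero hg, hl, hr, ← this]
  abel

theorem d_rightBr {g : A.carrier} (hdg : A.d g = 0) (x : A.carrier) :
    A.d (A.rightBr g x) = A.rightBr g (A.d x) := by
  have key : A.dHom.comp (A.rightBr g) = (A.rightBr g).comp A.dHom :=
    linearMap_ext_grading fun i x hx => by
      have := A.leibniz i x hx g
      rw [hdg, (A.br_lin₂ x).map_zero, smul_zero, add_zero] at this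
      exact this
  exact LinearMap.congr_fun key x

end DGLA

namespace GradedSplitting

variable {K : Type} [Field K] {A : DGLA K} (S : GradedSplitting A)

theorem exists_decomp {i : ℤ} {x : A.carrier} (hx : x ∈ A.grading i) :
    ∃ a ∈ S.H i, ∃ k ∈ S.Kc (i - 1), ∃ k' ∈ S.Kc i, x = a + (A.d k + k') := by
  rw [← S.decomp i] at hx
  obtain ⟨a, ha, y, hy, rfl⟩ := Submodule.mem_sup.1 hx
  obtain ⟨_, ⟨k, hk, rfl⟩, k', hk', rfl⟩ := Submodule.mem_sup.1 hy
  exact ⟨a, ha, k, hk, k', hk', rfl⟩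

variable {S} {N : Type*} [AddCommGroup N] [Module K N]

theorem linearMap_ext {φ ψ : A.carrier →ₗ[K] N}
    (hH : ∀ i, ∀ x ∈ S.H i, φ x = ψ x) (hd : ∀ i, ∀ x ∈ S.Kc i, φ (A.d x) = ψ (A.d x))
    (hK : ∀ i, ∀ x ∈ S.Kc i, φ x = ψ x) : φ = ψ :=
  DGLA.linearMap_ext_grading fun i x hx => by
    obtain ⟨a, ha, k, hk, k', hk', rfl⟩ := S.exists_decomp hx
    simp only [map_add, hH i a ha, hd _ k hk, hK i k' hk']

end GradedSplitting

namespace ContractionData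

variable {K : Type} [Field K] {A : DGLA K} {S : GradedSplitting A} (C : ContractionData A S)

theorem pr_d (x : A.carrier) : C.pr (A.d x) = 0 := by
  have pr_zero : C.pr 0 = 0 := C.pr_lin.map_zero
  have key : (IsLinearMap.mk' C.pr C.pr_lin).comp A.dHom = 0 :=
    GradedSplitting.linearMap_ext (S := S)
      (fun i x hx => (congrArg C.pr (S.d_H i x hx)).trans pr_zero)
      (fun _ x _ => (congrArg C.pr (A.d_sq x)).trans pr_zero)
      (fun i x hx => C.pr_dK i x hx)
  exact LinearMap.congr_fun key x

theorem h_rightBr {g : A.carrier} (hg : g ∈ S.H 0)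
    (hH : ∀ i, ∀ x ∈ S.H i, A.rightBr g x ∈ S.H i)
    (hK : ∀ i, ∀ x ∈ S.Kc i, A.rightBr g x ∈ S.Kc i) (x : A.carrier) :
    C.h (A.rightBr g x) = A.rightBr g (C.h x) := by
  have key : (IsLinearMap.mk' C.h C.h_lin).comp (A.rightBr g) =
      (A.rightBr g).comp (IsLinearMap.mk' C.h C.h_lin) := by
    refine GradedSplitting.linearMap_ext (S := S) (fun i x hx => ?_) (fun i x hx => ?_)
      (fun i x hx => ?_) <;> simp only [LinearMap.comp_apply, IsLinearMap.mk'_apply]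
    · rw [C.h_H i _ (hH i x hx), C.h_H i x hx, map_zero]
    · rw [← DGLA.d_rightBr (S.d_H 0 g hg), C.h_dK i _ (hK i x hx), C.h_dK i x hx,
        map_neg]
    · rw [C.h_K i _ (hK i x hx), C.h_K i x hx, map_zero]
  exact LinearMap.congr_fun key x

end ContractionData

theorem update_mem {K M : Type*} [Semiring K] [AddCommMonoid M] [Module K M] {κ : Type*}
    [DecidableEq κ] {V : Submodule K M} {v : κ → M} (hv : ∀ i, v i ∈ V) (i : κ) {x : M}
    (hx : x ∈ V) (j : κ) : update v i x j ∈ V := by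
  by_cases h : j = i
  · subst h; simpa using hx
  · simpa [h] using hv j

/-- The Taylor coefficients `ι_n` are equivariant on tuples of elements of `H^1`. -/
theorem IsTransfer.sum_iota_update_s12 {K : Type} [Field K] {A : DGLA K} {S : GradedSplitting A}
    {C : ContractionData A S} {ι bh : (p : ℕ) → (Fin p → A.carrier) → A.carrier}
    (hT : IsTransfer A S C ι bh) {g : A.carrier} (hg : g ∈ S.H 0)
    (hH : ∀ i, ∀ x ∈ S.H i, A.rightBr g x ∈ S.H i)
    (hK : ∀ i, ∀ x ∈ S.Kc i, A.rightBr g x ∈ S.Kc i) (n : ℕ) (hn : 0 < n)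
    (v : Fin n → A.carrier) (hv : ∀ i, v i ∈ S.H 1) :
    ∑ i, ι n (update v i (A.rightBr g (v i))) = A.rightBr g (ι n v) := by
  induction n using Nat.strong_induction_on with
  | _ n ih =>
  match n, hn with
  | 1, _ => simp [hT.iota_one]
  | p + 2, _ =>
    have hmem i := update_mem hv i (hH 1 _ (hv i))
    rw [hT.iota_rec p (fun _ => 1) v hv,
      Finset.sum_congr rfl fun i _ => hT.iota_rec p (fun _ => 1) _ (hmem i), ← Finset.smul_sum,
      map_smul, map_sum, Finset.sum_comm]
    congr 1
    refine Finset.sum_congr rfl fun k hk => ?_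
    obtain ⟨hk0, hkp⟩ := Finset.mem_Ioo.1 hk
    rw [map_sum, Finset.sum_comm]
    refine Finset.sum_congr rfl fun σ _ => ?_
    rw [← Finset.smul_sum, map_smul]
    congr 1
    have hl (s : Fin k) : σ (finIdx p s) = ((splitFin (p + 2) k hkp.le).trans σ) (.inl s) := by
      have : finIdx p s = splitFin (p + 2) k hkp.le (.inl s) :=
        Fin.ext (Nat.mod_eq_of_lt (by omega))
      rw [this]; rfl
    have hr (t : Fin (p + 2 - k)) :
        σ (finIdx p (k + t)) = ((splitFin (p + 2) k hkp.le).trans σ) (.inr t) := by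
      have : finIdx p (k + t) = splitFin (p + 2) k hkp.le (.inr t) :=
        Fin.ext (Nat.mod_eq_of_lt (by omega))
      rw [this]; rfl
    simp only [hl, hr]
    rw [← C.h_rightBr hg hH hK, DGLA.rightBr_br (S.H_le 0 hg)]
    have key := sum_bilin_update A.brHom (A.rightBr g) ((splitFin (p + 2) k hkp.le).trans σ)
      (ι k) (ι (p + 2 - k)) v (ih k hkp hk0 _ fun _ => hv _)
      (ih (p + 2 - k) (by omega) (by omega) _ fun _ => hv _)
    have h_sum := map_sum (IsLinearMap.mk' C.h C.h_lin) (fun i => A.brHom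
      (ι k fun s => update v i (A.rightBr g (v i)) (((splitFin (p + 2) k hkp.le).trans σ) (.inl s)))
      (ι (p + 2 - k) fun t =>
        update v i (A.rightBr g (v i)) (((splitFin (p + 2) k hkp.le).trans σ) (.inr t))))
      Finset.univ
    rw [key] at h_sum
    exact h_sum.symm

namespace QCyclicDGLA

variable {K : Type} [Field K] {n : ℤ} (A : QCyclicDGLA K n)

/-- The cyclic form bundled as a bilinear map. -/
def formHom : A.carrier →ₗ[K] A.carrier →ₗ[K] K :=
  LinearMap.mk₂ K A.form (fun x y z => (A.form_lin₁ z).map_add x y)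
    (fun c x z => (A.form_lin₁ z).map_smul c x) (fun x => (A.form_lin₂ x).map_add)
    (fun c x => (A.form_lin₂ x).map_smul c)

@[simp] theorem formHom_apply (x y : A.carrier) : A.formHom x y = A.form x y := rfl

variable {A}

theorem form_rightBr {g : A.carrier} (hg : g ∈ A.grading 0) (x y : A.carrier) :
    A.form (A.rightBr g x) y + A.form x (A.rightBr g y) = 0 := by
  have : A.form x (-A.br g y) = -A.form x (A.br g y) := (A.form_lin₂ x).map_neg _
  rw [DGLA.rightBr_apply, DGLA.rightBr_apply, A.form_cyclic, DGLA.br_skew_of_mem_zero hg y, this,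
    add_neg_cancel]

/-- The form is non-degenerate on the harmonic subspaces. -/
theorem eq_zero_of_form_eq_zero {S : GradedSplitting A.toDGLA} (C : ContractionData A.toDGLA S)
    {i : ℤ} {x : A.carrier} (hx : x ∈ S.H i) (h : ∀ y ∈ S.H (n - i), A.form x y = 0) : x = 0 := by
  have hdx : A.d x = 0 := S.d_H i x hx
  have hb : x ∈ A.coboundaries i := by
    refine A.nondeg i x ⟨S.H_le i hx, hdx⟩ fun y hy => ?_
    obtain ⟨a, ha, k, hk, k', hk', rfl⟩ := S.exists_decomp hy.1
    have hk0 : k' = 0 := by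
      refine S.d_Kc_inj _ k' hk' ?_
      have : A.dHom (a + (A.dHom k + k')) = 0 := hy.2
      rw [map_add, map_add, show A.dHom a = 0 from S.d_H _ a ha,
        show A.dHom (A.dHom k) = 0 from A.d_sq k, zero_add, zero_add] at this
      exact this
    have hform := A.form_d i x (S.H_le i hx) k
    rw [hdx, (A.form_lin₁ k).map_zero] at hform
    have hxk : A.form x (A.d k) = 0 :=
      (mul_eq_zero.1 hform.symm).resolve_left (zpow_ne_zero _ (neg_ne_zero.2 one_ne_zero))
    rw [hk0, add_zero, (A.form_lin₂ x).map_add, h a ha, hxk, add_zero]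
  obtain ⟨z, hz⟩ := hb.2
  rw [← C.pr_H i x hx, ← hz]
  exact C.pr_d z

/-- A pairing of two equivariant functions applied to complementary parts of a tuple is
invariant. -/
theorem sum_form_update {g : A.carrier} (hg : g ∈ A.grading 0)
    (a : (p : ℕ) → (Fin p → A.carrier) → A.carrier) (p j : ℕ) (hj : j ≤ p)
    (v : Fin p → A.carrier)
    (ha : ∑ s, a j (update (tupleTake p j hj v) s (A.rightBr g (tupleTake p j hj v s))) =
      A.rightBr g (a j (tupleTake p j hj v)))
    (hb : ∑ t, a (p - j) (update (tupleDrop p j hj v) t (A.rightBr g (tupleDrop p j hj v t))) =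
      A.rightBr g (a (p - j) (tupleDrop p j hj v))) :
    ∑ i, A.form (a j (tupleTake p j hj (update v i (A.rightBr g (v i)))))
      (a (p - j) (tupleDrop p j hj (update v i (A.rightBr g (v i))))) = 0 :=
  (sum_bilin_update A.formHom (A.rightBr g) (splitFin p j hj) (a j) (a (p - j)) v ha hb).trans
    (form_rightBr hg _ _)

end QCyclicDGLA

/-- Invariance of a function of `p + 1` arguments, rephrased with the last argument singled out
and the first `p` arguments permuted. -/
theorem sum_snoc_update {M N : Type*} [AddCommGroup N] {p : ℕ} (Φ : (Fin (p + 1) → M) → N)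
    (D : M → M) (v : Fin p → M) (ξ : M) (σ : Equiv.Perm (Fin p))
    (h : ∑ i, Φ (update (Fin.snoc (fun i => v (σ i)) ξ : Fin (p + 1) → M) i
      (D ((Fin.snoc (fun i => v (σ i)) ξ : Fin (p + 1) → M) i))) = 0) :
    ∑ i, Φ (Fin.snoc (fun s => update v i (D (v i)) (σ s)) ξ) =
      -Φ (Fin.snoc (fun i => v (σ i)) (D ξ)) := by
  rw [Fin.sum_univ_castSucc] at h
  simp only [Fin.snoc_castSucc, Fin.snoc_last, ← Fin.snoc_update, Fin.update_snoc_last] at h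
  rw [eq_neg_iff_add_eq_zero, ← h, ← Equiv.sum_comp σ]
  congr 1
  refine Finset.sum_congr rfl fun i _ => ?_
  congr 2
  ext s
  simp [update_apply]

namespace IsFFamily

variable {K : Type} [Field K] {A : QCyclicDGLA K 2} {S : GradedSplitting A.toDGLA}
  {ι bh f : (p : ℕ) → (Fin p → A.carrier) → A.carrier}

theorem mem_H_one (hf : IsFFamily A S ι f) {p : ℕ} (hp : 2 ≤ p) {v : Fin p → A.carrier}
    (hv : ∀ i, v i ∈ S.H 1) : f p v ∈ S.H 1 := by
  obtain rfl | hp := hp.eq_or_lt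
  · rw [hf.f_two]; exact zero_mem _
  · exact hf.f_mem p hp v hv

/-- The maps `f_p` are equivariant for the action of `H^0`. -/
theorem sum_update (hf : IsFFamily A S ι f) {C : ContractionData A.toDGLA S}
    (hT : IsTransfer A.toDGLA S C ι bh) {g : A.carrier} (hg : g ∈ S.H 0)
    (hH : ∀ i, ∀ x ∈ S.H i, A.rightBr g x ∈ S.H i)
    (hK : ∀ i, ∀ x ∈ S.Kc i, A.rightBr g x ∈ S.Kc i) (p : ℕ) (hp : 2 ≤ p)
    (v : Fin p → A.carrier) (hv : ∀ i, v i ∈ S.H 1) :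
    ∑ i, f p (update v i (A.rightBr g (v i))) = A.rightBr g (f p v) := by
  induction p using Nat.strong_induction_on with
  | _ p ih =>
  obtain rfl | hp3 := hp.eq_or_lt
  · simp [hf.f_two, (A.br_lin₁ g).map_zero]
  have hmem i := update_mem hv i (hH 1 _ (hv i))
  rw [← sub_eq_zero]
  refine QCyclicDGLA.eq_zero_of_form_eq_zero C (i := 1)
    (sub_mem (sum_mem fun i _ => hf.mem_H_one hp (hmem i)) (hH 1 _ (hf.mem_H_one hp hv)))
    fun ξ hξ => ?_
  replace hξ : ξ ∈ S.H 1 := hξ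
  have hg0 := S.H_le 0 hg
  rw [← A.formHom_apply, map_sub, LinearMap.sub_apply, map_sum, LinearMap.sum_apply, sub_eq_zero]
  simp only [A.formHom_apply]
  rw [eq_neg_of_add_eq_zero_left (QCyclicDGLA.form_rightBr hg0 (f p v) ξ),
    hf.f_rec p hp3 v hv _ (hH 1 ξ hξ), Finset.sum_congr rfl fun i _ =>
      hf.f_rec p hp3 _ (hmem i) ξ hξ, ← Finset.mul_sum, Finset.sum_comm, ← mul_neg,
    ← Finset.sum_neg_distrib]
  congr 1
  refine Finset.sum_congr rfl fun j _ => ?_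
  obtain ⟨hj2, hjp⟩ := Finset.mem_Ico.1 j.2
  rw [Finset.sum_comm, ← Finset.sum_neg_distrib]
  refine Finset.sum_congr rfl fun σ _ => ?_
  have hw : ∀ i, (Fin.snoc (fun i => v (σ i)) ξ : Fin (p + 1) → A.carrier) i ∈ S.H 1 :=
    Fin.lastCases (by simpa using hξ) fun i => by simpa using hv (σ i)
  refine sum_snoc_update (fun w => Ipair A ι (p + 1) j.1 (by omega) w -
    Fpair A f (p + 1) j.1 (by omega) w) (A.rightBr g) v ξ σ ?_
  rw [Finset.sum_sub_distrib]
  refine (congrArg₂ _ (QCyclicDGLA.sum_form_update hg0 ι (p + 1) j.1 (by omega) _ ?_ ?_)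
    (QCyclicDGLA.sum_form_update hg0 f (p + 1) j.1 (by omega) _ ?_ ?_)).trans (sub_zero 0)
  · exact hT.sum_iota_update_s12 hg hH hK _ (by omega) _ fun _ => hw _
  · exact hT.sum_iota_update_s12 hg hH hK _ (by omega) _ fun _ => hw _
  · exact ih _ hjp hj2 _ fun _ => hw _
  · exact ih _ (by omega) (by omega) _ fun _ => hw _

end IsFFamily

end

/-- **Lemma.**  In the standing setup of degree `2`, with `f` the recursively defined
family above: for every `p ≥ 2`, every `1 < j < p`, all `ξ₁, …, ξ_{p+1} ∈ H^1` and
every `g ∈ H^0`,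
(a) `Σ_{i=1}^p f_p(ξ₁, …, {ξ_i, g}₂, …, ξ_p) = {f_p(ξ₁, …, ξ_p), g}₂`, and
(b) `Σ_{i=1}^{p+1} F_j^{p+1}(ξ₁, …, {ξ_i, g}₂, …, ξ_{p+1}) = 0`. -/
theorem fFamily_equivariance
    {K : Type} [Field K] [CharZero K]
    (A : QCyclicDGLA K 2) (S : GradedSplitting A.toDGLA)
    (h1 : ∀ i : ℤ, i < 0 → S.H i = ⊥)
    (h2 : ∀ x ∈ S.H 0, ∀ y ∈ S.H 0, A.br x y ∈ S.H 0)
    (h3H : ∀ i : ℤ, ∀ g ∈ S.H 0, ∀ x ∈ S.H i, A.br g x ∈ S.H i)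
    (h3K : ∀ i : ℤ, ∀ g ∈ S.H 0, ∀ x ∈ S.Kc i, A.br g x ∈ S.Kc i)
    (hperp : ∀ i j : ℤ, ∀ x ∈ S.H i, ∀ y ∈ S.Kc j, A.form x y = 0)
    (C : ContractionData A.toDGLA S)
    (ι bh : (p : ℕ) → (Fin p → A.carrier) → A.carrier)
    (hT : IsTransfer A.toDGLA S C ι bh)
    (f : (p : ℕ) → (Fin p → A.carrier) → A.carrier)
    (hf : IsFFamily A S ι f) :
    -- (a)
    (∀ (p : ℕ), 2 ≤ p → ∀ v : Fin p → A.carrier, (∀ i, v i ∈ S.H 1) →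
      ∀ g ∈ S.H 0,
        ∑ i : Fin p, f p (Function.update v i (C.pr (A.br (v i) g))) =
          C.pr (A.br (f p v) g)) ∧
    -- (b)
    (∀ (p j : ℕ), 2 ≤ p → ∀ (hj : 1 < j) (hjp : j < p),
      ∀ v : Fin (p + 1) → A.carrier, (∀ i, v i ∈ S.H 1) → ∀ g ∈ S.H 0,
        ∑ i : Fin (p + 1),
          Fpair A f (p + 1) j (by omega)
            (Function.update v i (C.pr (A.br (v i) g))) = 0) := by
  have hD {g : A.carrier} (hg : g ∈ S.H 0) (x : A.carrier) : A.rightBr g x = -A.br g x :=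
    DGLA.br_skew_of_mem_zero (S.H_le 0 hg) x
  have hH {g : A.carrier} (hg : g ∈ S.H 0) (i : ℤ) (x : A.carrier) (hx : x ∈ S.H i) :
      A.rightBr g x ∈ S.H i := hD hg x ▸ neg_mem (h3H i g hg x hx)
  have hK {g : A.carrier} (hg : g ∈ S.H 0) (i : ℤ) (x : A.carrier) (hx : x ∈ S.Kc i) :
      A.rightBr g x ∈ S.Kc i := hD hg x ▸ neg_mem (h3K i g hg x hx)
  have hpr {g : A.carrier} (hg : g ∈ S.H 0) (x : A.carrier) (hx : x ∈ S.H 1) :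
      C.pr (A.br x g) = A.rightBr g x := C.pr_H 1 _ (hH hg 1 x hx)
  refine ⟨fun p hp v hv g hg => ?_, fun p j _ hj hjp v hv g hg => ?_⟩
  · rw [hpr hg _ (hf.mem_H_one hp hv)]
    simp only [hpr hg _ (hv _)]
    exact hf.sum_update hT hg (hH hg) (hK hg) p hp v hv
  · simp only [hpr hg _ (hv _)]
    exact QCyclicDGLA.sum_form_update (S.H_le 0 hg) f (p + 1) j (by omega) v
      (hf.sum_update hT hg (hH hg) (hK hg) _ hj _ fun _ => hv _)
      (hf.sum_update hT hg (hH hg) (hK hg) _ (by omega) _ fun _ => hv _)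
end
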